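/- Every minimal vanishing sorou h of weight 7 is either a rotation of {1, ν_7, ν_7^2, …, ν_7^6}, or there exist a subset J of {0, 1, 2, 3, 4} with |J| = 2 and a root of unity z such that z·h equals the multiset consisting of the elements ν_5^j for j ∉ J together with the elements −ν_3 ν_5^j and −ν_3^2 ν_5^j for j ∈ J. -/

import Mathlib

open Complex

noncomputable def nu (n : ℕ) : ℂ := Complex.exp (2 * Real.pi * Complex.I / n)

def IsRootOfUnity (z : ℂ) : Prop := ∃ n : ℕ, 0 < n ∧ z ^ n = 1

def IsSorou (h : Multiset ℂ) : Prop := h ≠ 0 ∧ ∀ z ∈ h, IsRootOfUnity z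

noncomputable def rootOrder (z : ℂ) : ℕ := sInf {d : ℕ | 0 < d ∧ z ^ d = 1}

noncomputable def sorouOrder (h : Multiset ℂ) : ℕ := (h.map rootOrder).lcm

noncomputable def relOrder (h : Multiset ℂ) : ℕ :=
  (h.bind fun a => h.map fun b => rootOrder (a / b)).lcm

def IsMinVanishing (h : Multiset ℂ) : Prop :=
  h.sum = 0 ∧ ∀ g : Multiset ℂ, g ≤ h → g ≠ 0 → g ≠ h → g.sum ≠ 0

theorem nu_isPrimitiveRoot {n : ℕ} (hn : n ≠ 0) : IsPrimitiveRoot (nu n) n :=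
  Complex.isPrimitiveRoot_exp n hn

/-- Galois conjugation preserves the vanishing of a sum of `N`-th roots of unity. -/
theorem sum_map_pow_eq_zero {N k : ℕ} (hN : N ≠ 0) (hk : k.Coprime N) {h : Multiset ℂ}
    (hh : ∀ x ∈ h, x ^ N = 1) (h0 : h.sum = 0) : (h.map fun x => x ^ k).sum = 0 := by
  have hζ := nu_isPrimitiveRoot hN
  have : NeZero N := ⟨hN⟩
  have key : ∀ x : ℂ, ∃ a : ℕ, x ^ N = 1 → nu N ^ a = x := fun x => by
    by_cases hx : x ^ N = 1
    · obtain ⟨a, -, ha⟩ := hζ.eq_pow_of_pow_eq_one hx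
      exact ⟨a, fun _ => ha⟩
    · exact ⟨0, fun h => absurd h hx⟩
  choose a ha using key
  let P : Polynomial ℤ := (h.map fun x => Polynomial.X ^ a x).sum
  have haeval : ∀ w : ℂ, Polynomial.aeval w P = (h.map fun x => w ^ a x).sum := fun w => by
    simp [P, map_multiset_sum, Multiset.map_map]
  have hP : Polynomial.aeval (nu N) P = 0 := by
    rw [haeval, Multiset.map_congr rfl fun x hx => ha x (hh x hx), Multiset.map_id', h0]
  have hdvd := minpoly.isIntegrallyClosed_dvd (hζ.isIntegral (Nat.pos_of_ne_zero hN)) hP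
  rw [hζ.minpoly_eq_pow_coprime hk] at hdvd
  have hz := Polynomial.aeval_eq_zero_of_dvd_aeval_eq_zero hdvd (minpoly.aeval ℤ (nu N ^ k))
  rw [haeval] at hz
  rw [← hz]
  congr 1
  refine Multiset.map_congr rfl fun x hx => ?_
  rw [← pow_mul, mul_comm, pow_mul, ha x (hh x hx)]

theorem sum_range_inv_mul_pow {p : ℕ} {c u : ℂ} (hc : c ^ p = 1) (hc0 : c ≠ 0) (hu : u ^ p = 1) :
    ∑ t ∈ Finset.range p, (c⁻¹ * u) ^ t = if u = c then (p : ℂ) else 0 := by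
  split_ifs with h
  · simp [h, hc0]
  · have h1 : c⁻¹ * u ≠ 1 := fun h' => h (by field_simp at h'; exact h')
    rw [geom_sum_eq h1, mul_pow, inv_pow, hc, hu]
    simp

/-- Fourier inversion on the group of `p`-th roots of unity. -/
theorem mul_sum_filter_eq {p : ℕ} (hp : p ≠ 0) {h : Multiset ℂ} {u v : ℂ → ℂ}
    (hu : ∀ x ∈ h, u x ^ p = 1) {c : ℂ} (hc : c ^ p = 1) :
    (p : ℂ) * ((h.filter fun x => u x = c).map v).sum =
      ∑ t ∈ Finset.range p, c⁻¹ ^ t * (h.map fun x => v x * u x ^ t).sum := by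
  have hc0 : c ≠ 0 := by
    rintro rfl
    simp [hp] at hc
  induction h using Multiset.induction_on with
  | empty => simp
  | cons a s ih =>
    have ha := sum_range_inv_mul_pow hc hc0 (hu a (Multiset.mem_cons_self a s))
    have hs := ih fun x hx => hu x (Multiset.mem_cons_of_mem hx)
    simp only [Multiset.map_cons, Multiset.sum_cons, mul_add, Finset.sum_add_distrib, ← hs]
    have : ∑ t ∈ Finset.range p, c⁻¹ ^ t * (v a * u a ^ t) =
        v a * if u a = c then (p : ℂ) else 0 := by
      rw [← ha, Finset.mul_sum]
      exact Finset.sum_congr rfl fun t _ => by rw [mul_pow]; ring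
    rw [this]
    by_cases hac : u a = c
    · simp [hac]
      ring
    · simp [hac]

theorem IsMinVanishing.eq_of_le {h g : Multiset ℂ} (hmv : IsMinVanishing h) (hle : g ≤ h)
    (hg : g ≠ 0) (h0 : g.sum = 0) : g = h := by
  by_contra hne
  exact hmv.2 g hle hg hne h0

theorem IsMinVanishing.forall_of_sum_filter_eq_zero {h : Multiset ℂ} (hmv : IsMinVanishing h)
    (P : ℂ → Prop) [DecidablePred P] (h0 : (h.filter P).sum = 0) {x : ℂ} (hx : x ∈ h) (hPx : P x) :
    ∀ y ∈ h, P y := by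
  have := hmv.eq_of_le (Multiset.filter_le P h)
    (fun h' => by simpa [h'] using Multiset.mem_filter.2 ⟨hx, hPx⟩) h0
  exact Multiset.filter_eq_self.1 this

theorem IsMinVanishing.map_mul {h : Multiset ℂ} (hmv : IsMinVanishing h) {z : ℂ} (hz : z ≠ 0) :
    IsMinVanishing (h.map fun x => z * x) := by
  refine ⟨by rw [Multiset.sum_map_mul_left]; simp [hmv.1], fun g hg hg0 hgh h0 => ?_⟩
  have hcancel : ∀ s : Multiset ℂ, (s.map fun x => z * x).map (fun x => z⁻¹ * x) = s := fun s => by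
    simp [Multiset.map_map, hz]
  have hcancel' : ∀ s : Multiset ℂ, (s.map fun x => z⁻¹ * x).map (fun x => z * x) = s := fun s => by
    simp [Multiset.map_map, hz]
  have hle := Multiset.map_le_map (f := fun x => z⁻¹ * x) hg
  rw [hcancel] at hle
  refine hmv.2 _ hle (by simpa using hg0) (fun h' => hgh ?_) ?_
  · rw [← h', hcancel']
  · rw [Multiset.sum_map_mul_left]
    simp [h0]

theorem IsMinVanishing.add_ne_zero {h : Multiset ℂ} (hmv : IsMinVanishing h)
    (hcard : Multiset.card h = 7) {x y : ℂ} (hle : ({x, y} : Multiset ℂ) ≤ h) : x + y ≠ 0 := by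
  intro h0
  have := congrArg Multiset.card (hmv.eq_of_le hle (by simp) (by simpa using h0))
  simp [hcard] at this

/-- Minimality among the exponents `N` for which some rotation of `h` lies in the `N`-th roots of
unity. -/
def IsReducedOrder (h : Multiset ℂ) (N : ℕ) : Prop :=
  ∀ M, 0 < M → ∀ x ∈ h, (∀ y ∈ h, (x⁻¹ * y) ^ M = 1) → N ≤ M

theorem IsReducedOrder.not_sq_dvd {h : Multiset ℂ} {N p : ℕ} (hred : IsReducedOrder h N)
    (hN : N ≠ 0) (hp : p.Prime) (hmv : IsMinVanishing h) (hh : ∀ x ∈ h, x ^ N = 1)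
    (hne : h ≠ 0) : ¬ p ^ 2 ∣ N := by
  rintro ⟨m, rfl⟩
  obtain ⟨x, hx⟩ := Multiset.exists_mem_of_ne_zero hne
  set M := p * m with hM
  have hNM : p ^ 2 * m = M * p := by rw [hM]; ring
  rw [hNM] at hh hN
  have hu : ∀ y ∈ h, (y ^ M) ^ p = 1 := fun y hy => by rw [← pow_mul, hh y hy]
  have hF := mul_sum_filter_eq hp.ne_zero (v := id) hu (hu x hx)
  rw [Finset.sum_eq_zero] at hF
  · have h0 : (h.filter fun y => y ^ M = x ^ M).sum = 0 := by
      simpa [hp.ne_zero] using hF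
    have hall := hmv.forall_of_sum_filter_eq_zero _ h0 hx rfl
    have hM0 : 0 < M := Nat.pos_of_ne_zero fun h => hN (by simp [h])
    have hxM : x ^ M ≠ 0 := fun h' => by simpa [h', hp.ne_zero] using hu x hx
    have := hred M hM0 x hx fun y hy => by
      rw [mul_pow, hall y hy, inv_pow, inv_mul_cancel₀ hxM]
    rw [hNM] at this
    nlinarith [hp.two_le]
  · intro t _
    have hcop : (1 + M * t).Coprime (M * p) := by
      have h1 : (1 + M * t).Coprime M := by simp
      exact h1.mul_right (h1.coprime_dvd_right ⟨m, hM⟩)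
    have := sum_map_pow_eq_zero hN hcop hh hmv.1
    simp only [pow_add, pow_one, pow_mul] at this
    simp only [id, this, mul_zero]

/-- Splitting the `p`-part off a minimal vanishing sum of roots of unity whose order is exactly
divisible by `p`: all the fibres are nonempty and have the same cofactor sum. -/
theorem IsReducedOrder.exists_fibres {h : Multiset ℂ} {N p : ℕ} (hred : IsReducedOrder h N)
    (hN : N ≠ 0) (hp : p.Prime) (hpN : p ∣ N) (hmv : IsMinVanishing h)
    (hh : ∀ x ∈ h, x ^ N = 1) (hne : h ≠ 0) :
    ∃ u v : ℂ → ℂ, ∃ S : ℂ, (∀ x ∈ h, u x ^ p = 1) ∧ (∀ x ∈ h, v x ^ (N / p) = 1) ∧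
      (∀ x ∈ h, x = v x * u x) ∧
      (∀ c, c ^ p = 1 → ((h.filter fun x => u x = c).map v).sum = S) ∧
      (∀ c, c ^ p = 1 → ∃ x ∈ h, u x = c) := by
  have hsq := hred.not_sq_dvd hN hp hmv hh hne
  obtain ⟨m, rfl⟩ := hpN
  have hm0 : m ≠ 0 := fun h' => hN (by simp [h'])
  have hpm : p.Coprime m := (Nat.Prime.coprime_iff_not_dvd hp).2 fun ⟨k, hk⟩ =>
    hsq ⟨k, by rw [hk]; ring⟩
  obtain ⟨e, hep, hem⟩ := Nat.chineseRemainder hpm 0 1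
  obtain ⟨f, hfp, hfm⟩ := Nat.chineseRemainder hpm 1 0
  have hpe : p ∣ e := (Nat.modEq_zero_iff_dvd).1 hep
  have hmf : m ∣ f := (Nat.modEq_zero_iff_dvd).1 hfm
  have hsplit : ∀ x ∈ h, x = x ^ e * x ^ f := fun x hx => by
    have h1 : e + f ≡ 1 [MOD p * m] :=
      (Nat.modEq_and_modEq_iff_modEq_mul hpm).1 ⟨hep.add hfp, hem.add hfm⟩
    rw [← pow_add]
    conv_lhs => rw [← pow_one x]
    exact (pow_eq_pow_of_modEq h1 (hh x hx)).symm
  have hu : ∀ x ∈ h, (x ^ f) ^ p = 1 := fun x hx => by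
    obtain ⟨k, rfl⟩ := hmf
    rw [← pow_mul, show m * k * p = p * m * k by ring, pow_mul, hh x hx, one_pow]
  have hv : ∀ x ∈ h, (x ^ e) ^ m = 1 := fun x hx => by
    obtain ⟨k, rfl⟩ := hpe
    rw [← pow_mul, show p * k * m = p * m * k by ring, pow_mul, hh x hx, one_pow]
  have hS : ∀ c : ℂ, c ^ p = 1 → ((h.filter fun x => x ^ f = c).map fun x => x ^ e).sum =
      (p : ℂ)⁻¹ * (h.map fun x => x ^ e).sum := fun c hc => by
    have hF := mul_sum_filter_eq hp.ne_zero (v := fun x => x ^ e) hu hc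
    rw [Finset.sum_eq_single 0] at hF
    · have hp0 : (p : ℂ) ≠ 0 := by exact_mod_cast hp.ne_zero
      rw [eq_inv_mul_iff_mul_eq₀ hp0, hF]
      simp
    · intro t ht ht0
      have hcop : (e + f * t).Coprime (p * m) := by
        refine Nat.Coprime.mul_right ?_ ?_
        · have h1 : e + f * t ≡ t [MOD p] := by simpa using hep.add (hfp.mul_right t)
          rw [Nat.Coprime, h1.gcd_eq]
          exact (Nat.coprime_of_lt_prime ht0 (Finset.mem_range.1 ht) hp).symm
        · have h1 : e + f * t ≡ 1 [MOD m] := by simpa using hem.add (hfm.mul_right t)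
          rw [Nat.Coprime, h1.gcd_eq]
          simp
      have := sum_map_pow_eq_zero hN hcop hh hmv.1
      simp only [pow_add, pow_mul] at this
      simp only [this, mul_zero]
    · simp [hp.ne_zero]
  refine ⟨fun x => x ^ f, fun x => x ^ e, _, hu, ?_, hsplit, hS, ?_⟩
  · rwa [Nat.mul_div_cancel_left _ hp.pos]
  · intro c hc
    by_contra! hempty
    have hS0 := hS c hc
    rw [Multiset.filter_eq_nil.2 hempty] at hS0
    obtain ⟨x, hx⟩ := Multiset.exists_mem_of_ne_zero hne
    have h0 : (h.filter fun y => y ^ f = x ^ f).sum = 0 := by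
      have h1 := hS _ (hu x hx)
      rw [← hS0] at h1
      have h2 : (h.filter fun y => y ^ f = x ^ f) =
          (h.filter fun y => y ^ f = x ^ f).map fun y => y ^ e * x ^ f := by
        conv_lhs => rw [← Multiset.map_id (h.filter fun y => y ^ f = x ^ f)]
        refine Multiset.map_congr rfl fun y hy => ?_
        rw [Multiset.mem_filter] at hy
        rw [← hy.2]
        exact hsplit y hy.1
      rw [h2, Multiset.sum_map_mul_right, h1]
      simp
    have hall := hmv.forall_of_sum_filter_eq_zero _ h0 hx rfl
    have hxf : x ^ f ≠ 0 := fun h' => by simpa [h', hp.ne_zero] using hu x hx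
    have := hred m (Nat.pos_of_ne_zero hm0) x hx fun y hy => by
      rw [hsplit y hy, hall y hy]
      nth_rw 1 [hsplit x hx]
      rw [mul_inv, mul_mul_mul_comm, inv_mul_cancel₀ hxf, mul_one, mul_pow, inv_pow, hv x hx,
        hv y hy]
      simp
    nlinarith [hp.two_le, Nat.pos_of_ne_zero hm0]

theorem nu_pow_nodup {p : ℕ} (hp : p ≠ 0) :
    ((Multiset.range p).map fun j => nu p ^ j).Nodup :=
  Multiset.Nodup.map_on (fun _ hi _ hj hij => (nu_isPrimitiveRoot hp).pow_inj
    (Multiset.mem_range.1 hi) (Multiset.mem_range.1 hj) hij) (Multiset.nodup_range p)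

theorem map_nu_pow_le {h : Multiset ℂ} {p : ℕ} (hp : p ≠ 0) {f : ℂ → ℂ}
    (hf : ∀ c : ℂ, c ^ p = 1 → c ∈ h.map f) :
    ((Multiset.range p).map fun j => nu p ^ j) ≤ h.map f := by
  rw [Multiset.le_iff_subset]
  · intro c hc
    obtain ⟨j, -, rfl⟩ := Multiset.mem_map.1 hc
    exact hf _ (by rw [← pow_mul, mul_comm, pow_mul, (nu_isPrimitiveRoot hp).pow_eq_one, one_pow])
  · exact nu_pow_nodup hp

theorem card_filter_eq_count (h : Multiset ℂ) (u : ℂ → ℂ) (c : ℂ) :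
    Multiset.card (h.filter fun x => u x = c) = (h.map u).count c := by
  rw [Multiset.count_map]
  simp only [eq_comm]

theorem eq_map_mul_of_forall_eq {h : Multiset ℂ} {u v : ℂ → ℂ} {S : ℂ}
    (hx : ∀ x ∈ h, x = v x * u x) (hv : ∀ x ∈ h, v x = S) :
    h = (h.map u).map fun c => S * c := by
  rw [Multiset.map_map]
  conv_lhs => rw [← Multiset.map_id h]
  refine Multiset.map_congr rfl fun x hxh => ?_
  rw [Function.comp, ← hv x hxh]
  exact hx x hxh

theorem eq_map_of_map_eq_nu_seven {h : Multiset ℂ} {u v : ℂ → ℂ} {S : ℂ}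
    (hx : ∀ x ∈ h, x = v x * u x) (hu : ∀ x ∈ h, u x ^ 7 = 1)
    (hS : ∀ c, c ^ 7 = 1 → ((h.filter fun x => u x = c).map v).sum = S)
    (hmap : h.map u = (Multiset.range 7).map fun j => nu 7 ^ j) :
    (∀ x ∈ h, v x = S) ∧ h = (Multiset.range 7).map fun j => S * nu 7 ^ j := by
  have hv : ∀ x ∈ h, v x = S := fun x hxh => by
    have hc : Multiset.card (h.filter fun y => u y = u x) = 1 := by
      rw [card_filter_eq_count]
      refine Multiset.count_eq_one_of_mem ?_ (Multiset.mem_map_of_mem u hxh)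
      rw [hmap]
      exact nu_pow_nodup (by norm_num)
    obtain ⟨y, hy⟩ := Multiset.card_eq_one.1 hc
    have hxy : x ∈ h.filter fun y => u y = u x := Multiset.mem_filter.2 ⟨hxh, rfl⟩
    rw [hy, Multiset.mem_singleton] at hxy
    have := hS _ (hu x hxh)
    rw [hy] at this
    simpa [hxy] using this
  refine ⟨hv, ?_⟩
  conv_lhs => rw [eq_map_mul_of_forall_eq hx hv, hmap, Multiset.map_map]
  rfl

theorem one_add_nu_three_add_sq : 1 + nu 3 + nu 3 ^ 2 = 0 := by
  have := (nu_isPrimitiveRoot (n := 3) (by norm_num)).geom_sum_eq_zero (by norm_num)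
  simpa [Finset.sum_range_succ] using this

theorem inv_eq_conj_of_pow_eq_one {a : ℂ} {n : ℕ} (hn : n ≠ 0) (ha : a ^ n = 1) :
    a⁻¹ = (starRingEnd ℂ) a :=
  Complex.inv_eq_conj (Complex.norm_eq_one_of_pow_eq_one ha hn)

theorem ne_zero_of_pow_eq_one {a : ℂ} {n : ℕ} (hn : n ≠ 0) (ha : a ^ n = 1) : a ≠ 0 := by
  rintro rfl
  simp [hn] at ha

theorem pair_eq_of_add_eq {n : ℕ} (hn : n ≠ 0) {a b S : ℂ} (ha : a ^ n = 1) (hb : b ^ n = 1)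
    (hS : S ^ n = 1) (hab : a + b = S) :
    ({a, b} : Multiset ℂ) = {-(nu 3 * S), -(nu 3 ^ 2 * S)} := by
  have ha0 := ne_zero_of_pow_eq_one hn ha
  have hb0 := ne_zero_of_pow_eq_one hn hb
  have hS0 := ne_zero_of_pow_eq_one hn hS
  have hconj : a⁻¹ + b⁻¹ = S⁻¹ := by
    rw [inv_eq_conj_of_pow_eq_one hn ha, inv_eq_conj_of_pow_eq_one hn hb,
      inv_eq_conj_of_pow_eq_one hn hS, ← hab, map_add]
  have hprod : S * S = a * b := by
    field_simp at hconj
    rw [← hab] at hconj ⊢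
    linear_combination hconj
  have hω := one_add_nu_three_add_sq
  have hω3 : nu 3 ^ 3 = 1 := (nu_isPrimitiveRoot (by norm_num)).pow_eq_one
  have hfac : (a + nu 3 * S) * (a + nu 3 ^ 2 * S) = 0 := by
    linear_combination (S * a) * hω + S ^ 2 * hω3 + hprod + a * hab
  rcases mul_eq_zero.1 hfac with h | h
  · have h1 : a = -(nu 3 * S) := by linear_combination h
    have h2 : b = -(nu 3 ^ 2 * S) := by linear_combination hab - h + S * hω
    rw [h1, h2]
  · have h1 : a = -(nu 3 ^ 2 * S) := by linear_combination h
    have h2 : b = -(nu 3 * S) := by linear_combination hab - h + S * hω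
    rw [h1, h2, Multiset.pair_comm]

theorem add_eq_zero_of_add_add_eq {n : ℕ} (hn : n ≠ 0) {a b d S : ℂ} (ha : a ^ n = 1)
    (hb : b ^ n = 1) (hd : d ^ n = 1) (hS : S ^ n = 1) (hab : a + b + d = S) :
    a + b = 0 ∨ a + d = 0 ∨ b + d = 0 := by
  have ha0 := ne_zero_of_pow_eq_one hn ha
  have hb0 := ne_zero_of_pow_eq_one hn hb
  have hd0 := ne_zero_of_pow_eq_one hn hd
  have hS0 := ne_zero_of_pow_eq_one hn hS
  have hconj : a⁻¹ + b⁻¹ + d⁻¹ = S⁻¹ := by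
    rw [inv_eq_conj_of_pow_eq_one hn ha, inv_eq_conj_of_pow_eq_one hn hb,
      inv_eq_conj_of_pow_eq_one hn hd, inv_eq_conj_of_pow_eq_one hn hS, ← hab, map_add, map_add]
  have hprod : (a + b) * ((a + d) * (b + d)) = 0 := by
    field_simp at hconj
    rw [← hab] at hconj
    linear_combination hconj
  simpa using hprod

/-- The shape of a weight-seven sum with five fibres. -/
theorem exists_subset_of_five_fibres {h : Multiset ℂ} (hmv : IsMinVanishing h)
    (hcard : Multiset.card h = 7) {n : ℕ} (hn : n ≠ 0) {u v : ℂ → ℂ} {S : ℂ}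
    (hu : ∀ x ∈ h, u x ^ 5 = 1) (hv : ∀ x ∈ h, v x ^ n = 1)
    (hx : ∀ x ∈ h, x = v x * u x)
    (hS : ∀ c, c ^ 5 = 1 → ((h.filter fun x => u x = c).map v).sum = S)
    (hsurj : ∀ c, c ^ 5 = 1 → ∃ x ∈ h, u x = c) :
    ∃ J : Finset ℕ, J ⊆ Finset.range 5 ∧ J.card = 2 ∧
      ∃ z : ℂ, IsRootOfUnity z ∧
        h.map (fun w => z * w) =
          ((Finset.range 5 \ J).val.map fun j => nu 5 ^ j) +
          (J.val.bind fun j =>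
            ({-(nu 3 * nu 5 ^ j), -(nu 3 ^ 2 * nu 5 ^ j)} : Multiset ℂ)) := by
  have h5 := nu_isPrimitiveRoot (n := 5) (by norm_num)
  have hpow : ∀ l, (nu 5 ^ l) ^ 5 = 1 := fun l => by
    rw [← pow_mul, mul_comm, pow_mul, h5.pow_eq_one, one_pow]
  have hle : ((Multiset.range 5).map fun j => nu 5 ^ j) ≤ h.map u :=
    map_nu_pow_le (by norm_num) fun c hc => by
      obtain ⟨x, hxh, rfl⟩ := hsurj c hc
      exact Multiset.mem_map_of_mem u hxh
  obtain ⟨r, hr⟩ := Multiset.le_iff_exists_add.1 hle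
  have hrcard : Multiset.card r = 2 := by
    have := congrArg Multiset.card hr
    simp [hcard] at this
    omega
  obtain ⟨a, b, rfl⟩ := Multiset.card_eq_two.1 hrcard
  have hab : ∀ c ∈ ({a, b} : Multiset ℂ), ∃ i < 5, nu 5 ^ i = c := fun c hc => by
    have : c ∈ h.map u := by
      rw [hr]
      exact Multiset.mem_add.2 (Or.inr hc)
    obtain ⟨x, hxh, rfl⟩ := Multiset.mem_map.1 this
    exact h5.eq_pow_of_pow_eq_one (hu x hxh)
  obtain ⟨i, hi, rfl⟩ := hab a (by simp)
  obtain ⟨j, hj, rfl⟩ := hab b (by simp)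
  have hinj : ∀ {l k}, l < 5 → k < 5 → (nu 5 ^ l = nu 5 ^ k ↔ l = k) := fun hl hk =>
    ⟨fun h' => h5.pow_inj hl hk h', fun h' => by rw [h']⟩
  have hcount : ∀ l < 5, Multiset.card (h.filter fun x => u x = nu 5 ^ l) =
      1 + ((if l = i then 1 else 0) + if l = j then 1 else 0) := fun l hl => by
    rw [card_filter_eq_count, hr, Multiset.count_add, Multiset.count_eq_one_of_mem
      (nu_pow_nodup (by norm_num)) (Multiset.mem_map_of_mem _ (Multiset.mem_range.2 hl)),
      Multiset.insert_eq_cons, Multiset.count_cons, Multiset.count_singleton]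
    simp only [hinj hl hi, hinj hl hj]
    ring
  have hmem : ∀ l < 5, ∀ y ∈ h.filter fun x => u x = nu 5 ^ l, v y ^ n = 1 ∧ y = v y * nu 5 ^ l :=
    fun l hl y hy => by
      rw [Multiset.mem_filter] at hy
      refine ⟨hv y hy.1, ?_⟩
      rw [← hy.2]
      exact hx y hy.1
  obtain ⟨k, hk, hki, hkj⟩ : ∃ k < 5, k ≠ i ∧ k ≠ j := by
    by_cases h0 : 0 ≠ i ∧ 0 ≠ j
    · exact ⟨0, by omega, h0⟩
    · by_cases h1 : 1 ≠ i ∧ 1 ≠ j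
      · exact ⟨1, by omega, h1⟩
      · exact ⟨2, by omega, by omega, by omega⟩
  have hSn : S ^ n = 1 := by
    have hc := hcount k hk
    simp only [hki, hkj, if_false, add_zero] at hc
    obtain ⟨y, hy⟩ := Multiset.card_eq_one.1 hc
    have h1 := hS _ (hpow k)
    rw [hy] at h1
    rw [← h1]
    simpa using (hmem k hk y (by rw [hy]; simp)).1
  have hS0 := ne_zero_of_pow_eq_one hn hSn
  have hij : i ≠ j := by
    rintro rfl
    have hc := hcount i hi
    simp only [if_true] at hc
    obtain ⟨x, y, w, hxyw⟩ := Multiset.card_eq_three.1 hc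
    have h1 := hS _ (hpow i)
    have hm := hmem i hi
    have hle := Multiset.filter_le (fun x => u x = nu 5 ^ i) h
    rw [hxyw] at h1 hm hle
    obtain ⟨hx1, hx2⟩ := hm x (by simp)
    obtain ⟨hy1, hy2⟩ := hm y (by simp)
    obtain ⟨hw1, hw2⟩ := hm w (by simp)
    simp only [Multiset.insert_eq_cons, Multiset.map_cons, Multiset.map_singleton,
      Multiset.sum_cons, Multiset.sum_singleton, ← add_assoc] at h1
    have hpair : ∀ {s t : ℂ}, s = v s * nu 5 ^ i → t = v t * nu 5 ^ i → v s + v t = 0 →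
        s + t = 0 := fun hs ht h0 => by
      rw [hs, ht, ← add_mul, h0, zero_mul]
    rcases add_eq_zero_of_add_add_eq hn hx1 hy1 hw1 hSn h1 with h0 | h0 | h0
    · refine hmv.add_ne_zero hcard (le_trans ?_ hle) (hpair hx2 hy2 h0)
      simp only [Multiset.insert_eq_cons, Multiset.cons_le_cons_iff]
      exact Multiset.le_iff_exists_add.2 ⟨{w}, rfl⟩
    · refine hmv.add_ne_zero hcard (le_trans ?_ hle) (hpair hx2 hw2 h0)
      simp only [Multiset.insert_eq_cons, Multiset.cons_le_cons_iff]
      exact Multiset.le_cons_self _ _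
    · refine hmv.add_ne_zero hcard (le_trans ?_ hle) (hpair hy2 hw2 h0)
      exact Multiset.le_cons_self _ _
  have hpart : ∀ l < 5, (h.filter fun x => u x = nu 5 ^ l).map (fun w => S⁻¹ * w) =
      if l ∈ ({i, j} : Finset ℕ) then
        ({-(nu 3 * nu 5 ^ l), -(nu 3 ^ 2 * nu 5 ^ l)} : Multiset ℂ) else {nu 5 ^ l} := by
    intro l hl
    have h1 := hS _ (hpow l)
    have hm := hmem l hl
    have hc := hcount l hl
    split_ifs with hlJ
    · have hc2 : Multiset.card (h.filter fun x => u x = nu 5 ^ l) = 2 := by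
        simp only [Finset.mem_insert, Finset.mem_singleton] at hlJ
        rcases hlJ with rfl | rfl
        · simpa [hij] using hc
        · simpa [hij.symm] using hc
      obtain ⟨x, y, hxy⟩ := Multiset.card_eq_two.1 hc2
      rw [hxy] at h1 hm ⊢
      obtain ⟨hx1, hx2⟩ := hm x (by simp)
      obtain ⟨hy1, hy2⟩ := hm y (by simp)
      have h2 := pair_eq_of_add_eq hn hx1 hy1 hSn (by simpa using h1)
      have h3 := congrArg (Multiset.map fun w => S⁻¹ * (w * nu 5 ^ l)) h2
      simp only [Multiset.insert_eq_cons, Multiset.map_cons, Multiset.map_singleton,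
        ← hx2, ← hy2] at h3 ⊢
      rw [h3]
      congr 2 <;> field_simp
    · simp only [Finset.mem_insert, Finset.mem_singleton, not_or] at hlJ
      simp only [hlJ.1, hlJ.2, if_false, add_zero] at hc
      obtain ⟨x, hxl⟩ := Multiset.card_eq_one.1 hc
      rw [hxl] at h1 hm ⊢
      have hx2 := (hm x (by simp)).2
      simp only [Multiset.map_singleton, Multiset.sum_singleton] at h1 ⊢
      rw [hx2, h1]
      congr 1
      field_simp
  have hJ : ({i, j} : Finset ℕ) ⊆ Finset.range 5 := by
    intro l hl
    simp only [Finset.mem_insert, Finset.mem_singleton] at hl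
    rcases hl with rfl | rfl <;> simpa
  refine ⟨{i, j}, hJ, Finset.card_pair hij, S⁻¹, ⟨n, Nat.pos_of_ne_zero hn, by simp [hSn]⟩, ?_⟩
  have hdecomp : h = ∑ l ∈ Finset.range 5, h.filter fun x => u x = nu 5 ^ l := by
    ext x
    rw [Multiset.count_sum']
    by_cases hxh : x ∈ h
    · obtain ⟨l, hl, hlx⟩ := h5.eq_pow_of_pow_eq_one (hu x hxh)
      rw [Finset.sum_eq_single_of_mem l (Finset.mem_range.2 hl)]
      · exact (Multiset.count_filter_of_pos (p := fun x => u x = nu 5 ^ l) hlx.symm).symm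
      · intro l' hl' hne
        refine Multiset.count_filter_of_neg (p := fun x => u x = nu 5 ^ l') ?_
        rw [← hlx, hinj hl (Finset.mem_range.1 hl')]
        exact hne.symm
    · rw [Multiset.count_eq_zero_of_notMem hxh, Finset.sum_eq_zero]
      intro l _
      exact Multiset.count_eq_zero_of_notMem fun h' => hxh (Multiset.mem_filter.1 h').1
  calc h.map (fun w => S⁻¹ * w)
      = ∑ l ∈ Finset.range 5, (h.filter fun x => u x = nu 5 ^ l).map (fun w => S⁻¹ * w) := by
        conv_lhs => rw [hdecomp]
        exact map_sum (Multiset.mapAddMonoidHom fun w => S⁻¹ * w) _ _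
    _ = ∑ l ∈ Finset.range 5, if l ∈ ({i, j} : Finset ℕ) then
          ({-(nu 3 * nu 5 ^ l), -(nu 3 ^ 2 * nu 5 ^ l)} : Multiset ℂ) else {nu 5 ^ l} :=
        Finset.sum_congr rfl fun l hl => hpart l (Finset.mem_range.1 hl)
    _ = _ := by
        rw [← Finset.sum_sdiff hJ]
        congr 1
        · rw [Finset.sum_congr rfl fun l hl => if_neg (Finset.mem_sdiff.1 hl).2]
          exact Multiset.bind_singleton _ _
        · rw [Finset.sum_congr rfl fun l hl => if_pos hl]
          rfl

theorem IsMinVanishing.neg_notMem {h : Multiset ℂ} (hmv : IsMinVanishing h)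
    (hcard : Multiset.card h = 7) {x : ℂ} (hx0 : x ≠ 0) (hx : x ∈ h) : -x ∉ h := by
  intro hx'
  refine hmv.add_ne_zero hcard (x := x) (y := -x) ?_ (add_neg_cancel x)
  rw [Multiset.le_iff_subset (by simpa using self_ne_neg.2 hx0)]
  intro y hy
  simp only [Multiset.insert_eq_cons, Multiset.mem_cons, Multiset.mem_singleton] at hy
  rcases hy with rfl | rfl <;> assumption

/-- No minimal vanishing sum of weight seven consists of sixth roots of unity. -/
theorem IsReducedOrder.not_dvd_six {h : Multiset ℂ} {N : ℕ} (hred : IsReducedOrder h N)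
    (hN : N ≠ 0) (hmv : IsMinVanishing h) (hcard : Multiset.card h = 7)
    (hh : ∀ x ∈ h, x ^ N = 1) : ¬ N ∣ 6 := by
  intro hdvd
  have hne : h ≠ 0 := by
    rintro rfl
    simp at hcard
  have h0 : ∀ x ∈ h, x ≠ 0 := fun x hx => ne_zero_of_pow_eq_one hN (hh x hx)
  obtain ⟨x₀, hx₀⟩ := Multiset.exists_mem_of_ne_zero hne
  by_cases h3 : 3 ∣ N
  · obtain ⟨u, v, S, hu, hv, hx, hS, hsurj⟩ :=
      hred.exists_fibres hN Nat.prime_three h3 hmv hh hne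
    have hv2 : ∀ x ∈ h, ∀ y ∈ h, v x = v y ∨ v x = -v y := by
      obtain ⟨m, rfl⟩ := h3
      rw [Nat.mul_div_cancel_left _ (by norm_num)] at hv
      obtain ⟨k, hk⟩ := hdvd
      have hk2 : 2 = m * k := by linarith
      intro x hxh y hyh
      rw [← sq_eq_sq_iff_eq_or_eq_neg, hk2, pow_mul, pow_mul, hv x hxh, hv y hyh]
    have hv0 : ∀ x ∈ h, v x ≠ 0 := fun x hxh h' => h0 x hxh (by rw [hx x hxh, h', zero_mul])
    have hSx : ∀ x ∈ h, ∃ n : ℕ, 0 < n ∧ S = n * v x := fun x hxh => by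
      refine ⟨Multiset.card (h.filter fun y => u y = u x),
        Multiset.card_pos_iff_exists_mem.2 ⟨x, Multiset.mem_filter.2 ⟨hxh, rfl⟩⟩, ?_⟩
      rw [← hS _ (hu x hxh), Multiset.map_congr rfl (g := fun _ => v x)]
      · simp
      · intro y hy
        rw [Multiset.mem_filter] at hy
        refine (hv2 y hy.1 x hxh).resolve_right fun h' => ?_
        refine hmv.neg_notMem hcard (h0 x hxh) hxh ?_
        have : -x = y := by rw [hx y hy.1, h', hy.2, neg_mul, ← hx x hxh]
        rw [this]
        exact hy.1
    have hconst : ∀ x ∈ h, v x = v x₀ := fun x hxh => by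
      refine (hv2 x hxh x₀ hx₀).resolve_right fun h' => ?_
      obtain ⟨n, hn, hSn⟩ := hSx x hxh
      obtain ⟨k, -, hSk⟩ := hSx x₀ hx₀
      have : ((n + k : ℕ) : ℂ) * v x₀ = 0 := by
        rw [h'] at hSn
        push_cast
        linear_combination hSn - hSk
      rcases mul_eq_zero.1 this with h1 | h1
      · have := Nat.cast_eq_zero.1 h1
        omega
      · exact hv0 x₀ hx₀ h1
    have hle : ((Multiset.range 3).map fun j => nu 3 ^ j) ≤ h.map u :=
      map_nu_pow_le (by norm_num) fun c hc => by
        obtain ⟨x, hxh, rfl⟩ := hsurj c hc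
        exact Multiset.mem_map_of_mem u hxh
    have hle' := Multiset.map_le_map (f := fun c => v x₀ * c) hle
    rw [← eq_map_mul_of_forall_eq hx hconst] at hle'
    have hcard3 := congrArg Multiset.card (hmv.eq_of_le hle' (by simp) ?_)
    · simp [hcard] at hcard3
    · rw [Multiset.sum_map_mul_left, Multiset.map_id']
      refine mul_eq_zero_of_right _ ?_
      exact (nu_isPrimitiveRoot (n := 3) (by norm_num)).geom_sum_eq_zero (by norm_num)
  · have h2 : N ∣ 2 :=
      ((Nat.Prime.coprime_iff_not_dvd Nat.prime_three).2 h3).symm.dvd_of_dvd_mul_left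
        (m := 3) (by simpa using hdvd)
    obtain ⟨k, hk⟩ := h2
    have hall : ∀ y ∈ h, y = x₀ := fun y hy => by
      have : y ^ 2 = x₀ ^ 2 := by rw [hk, pow_mul, pow_mul, hh y hy, hh x₀ hx₀]
      refine (sq_eq_sq_iff_eq_or_eq_neg.1 this).resolve_right fun h' => ?_
      exact hmv.neg_notMem hcard (h0 x₀ hx₀) hx₀ (h' ▸ hy)
    have hsum := hmv.1
    rw [Multiset.eq_replicate.2 ⟨hcard, hall⟩] at hsum
    rw [Multiset.sum_replicate, nsmul_eq_mul] at hsum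
    simp [h0 x₀ hx₀] at hsum

theorem IsSorou.exists_pow_eq_one {h : Multiset ℂ} (hs : ∀ z ∈ h, IsRootOfUnity z) :
    ∃ N : ℕ, 0 < N ∧ ∀ x ∈ h, x ^ N = 1 := by
  induction h using Multiset.induction_on with
  | empty => exact ⟨1, one_pos, by simp⟩
  | cons a s ih =>
    obtain ⟨N, hN, hsN⟩ := ih fun z hz => hs z (Multiset.mem_cons_of_mem hz)
    obtain ⟨M, hM, haM⟩ := hs a (Multiset.mem_cons_self a s)
    refine ⟨M * N, Nat.mul_pos hM hN, fun x hx => ?_⟩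
    rcases Multiset.mem_cons.1 hx with rfl | hx
    · rw [pow_mul, haM, one_pow]
    · rw [mul_comm, pow_mul, hsN x hx, one_pow]

theorem IsRootOfUnity.mul {a b : ℂ} (ha : IsRootOfUnity a) (hb : IsRootOfUnity b) :
    IsRootOfUnity (a * b) := by
  obtain ⟨n, hn, han⟩ := ha
  obtain ⟨m, hm, hbm⟩ := hb
  refine ⟨n * m, Nat.mul_pos hn hm, ?_⟩
  rw [mul_pow, pow_mul, han, mul_comm n m, pow_mul, hbm, one_pow, one_pow, one_mul]

theorem IsRootOfUnity.inv {a : ℂ} (ha : IsRootOfUnity a) : IsRootOfUnity a⁻¹ := by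
  obtain ⟨n, hn, han⟩ := ha
  exact ⟨n, hn, by rw [inv_pow, han, inv_one]⟩

/-- The classification of minimal vanishing sums of weight seven, for a rotation of minimal
order. -/
theorem IsReducedOrder.classification {h : Multiset ℂ} {N : ℕ} (hred : IsReducedOrder h N)
    (hN : N ≠ 0) (hmv : IsMinVanishing h) (hcard : Multiset.card h = 7)
    (hh : ∀ x ∈ h, x ^ N = 1) :
    (∃ z : ℂ, IsRootOfUnity z ∧ h = (Multiset.range 7).map fun j => z * nu 7 ^ j) ∨
    (∃ J : Finset ℕ, J ⊆ Finset.range 5 ∧ J.card = 2 ∧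
      ∃ z : ℂ, IsRootOfUnity z ∧
        h.map (fun w => z * w) =
          ((Finset.range 5 \ J).val.map fun j => nu 5 ^ j) +
          (J.val.bind fun j =>
            ({-(nu 3 * nu 5 ^ j), -(nu 3 ^ 2 * nu 5 ^ j)} : Multiset ℂ))) := by
  have hne : h ≠ 0 := by
    rintro rfl
    simp at hcard
  have hdiv : ∀ {p : ℕ}, p.Prime → p ∣ N → N / p ≠ 0 := fun hp hpN =>
    (Nat.div_pos (Nat.le_of_dvd (Nat.pos_of_ne_zero hN) hpN) hp.pos).ne'
  have hle7 : ∀ {p : ℕ}, p.Prime → p ∣ N → p ≤ 7 := fun {p} hp hpN => by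
    obtain ⟨u, v, S, -, -, -, -, hsurj⟩ := hred.exists_fibres hN hp hpN hmv hh hne
    have hle := map_nu_pow_le (h := h) (f := u) hp.ne_zero fun c hc => by
      obtain ⟨x, hxh, rfl⟩ := hsurj c hc
      exact Multiset.mem_map_of_mem u hxh
    simpa [hcard] using Multiset.card_le_card hle
  by_cases h7 : 7 ∣ N
  · have hp7 : Nat.Prime 7 := by norm_num
    obtain ⟨u, v, S, hu, hv, hx, hS, hsurj⟩ := hred.exists_fibres hN hp7 h7 hmv hh hne
    have hle := map_nu_pow_le (h := h) (f := u) hp7.ne_zero fun c hc => by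
      obtain ⟨x, hxh, rfl⟩ := hsurj c hc
      exact Multiset.mem_map_of_mem u hxh
    have hmap := (Multiset.eq_of_le_of_card_le hle (by simp [hcard])).symm
    obtain ⟨hvS, heq⟩ := eq_map_of_map_eq_nu_seven hx hu hS hmap
    obtain ⟨x, hxh⟩ := Multiset.exists_mem_of_ne_zero hne
    exact Or.inl ⟨S, ⟨N / 7, Nat.pos_of_ne_zero (hdiv hp7 h7), hvS x hxh ▸ hv x hxh⟩, heq⟩
  by_cases h5 : 5 ∣ N
  · obtain ⟨u, v, S, hu, hv, hx, hS, hsurj⟩ :=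
      hred.exists_fibres hN Nat.prime_five h5 hmv hh hne
    exact Or.inr (exists_subset_of_five_fibres hmv hcard (hdiv Nat.prime_five h5) hu hv hx hS
      hsurj)
  refine absurd ?_ (hred.not_dvd_six hN hmv hcard hh)
  have hsq : Squarefree N := Nat.squarefree_iff_prime_squarefree.2 fun p hp hpp =>
    hred.not_sq_dvd hN hp hmv hh hne (by rwa [sq])
  rw [← Nat.prod_primeFactors_of_squarefree hsq]
  have hsub : N.primeFactors ⊆ {2, 3} := fun p hp => by
    have hpp := Nat.prime_of_mem_primeFactors hp
    have hpN := Nat.dvd_of_mem_primeFactors hp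
    have := hle7 hpp hpN
    interval_cases p <;> first | contradiction | (norm_num at hpp; done) | simp
  exact (Finset.prod_dvd_prod_of_subset _ _ _ hsub).trans (by simp)

theorem stmt_15 (h : Multiset ℂ) (hs : IsSorou h) (hmv : IsMinVanishing h)
    (hcard : Multiset.card h = 7) :
    (∃ z : ℂ, IsRootOfUnity z ∧ h = (Multiset.range 7).map fun j => z * nu 7 ^ j) ∨
    (∃ J : Finset ℕ, J ⊆ Finset.range 5 ∧ J.card = 2 ∧
      ∃ z : ℂ, IsRootOfUnity z ∧
        h.map (fun w => z * w) =
          ((Finset.range 5 \ J).val.map fun j => nu 5 ^ j) +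
          (J.val.bind fun j =>
            ({-(nu 3 * nu 5 ^ j), -(nu 3 ^ 2 * nu 5 ^ j)} : Multiset ℂ))) := by
  have hex : ∃ N : ℕ, 0 < N ∧ ∃ z : ℂ, IsRootOfUnity z ∧ ∀ x ∈ h, (z * x) ^ N = 1 := by
    obtain ⟨N, hN, hh⟩ := IsSorou.exists_pow_eq_one hs.2
    exact ⟨N, hN, 1, ⟨1, by simp⟩, by simpa using hh⟩
  classical
  obtain ⟨hN, z, hz, hzh⟩ := Nat.find_spec hex
  have hmin := fun M => Nat.find_min' hex (m := M)
  generalize Nat.find hex = N at hN hzh hmin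
  have hz0 : z ≠ 0 := by
    obtain ⟨n, hn, hzn⟩ := hz
    exact ne_zero_of_pow_eq_one hn.ne' hzn
  have hred : IsReducedOrder (h.map fun x => z * x) N := by
    intro M hM x hx hxM
    obtain ⟨x, hxh, rfl⟩ := Multiset.mem_map.1 hx
    refine hmin M ⟨hM, x⁻¹, (hs.2 x hxh).inv, fun y hy => ?_⟩
    have := hxM (z * y) (Multiset.mem_map_of_mem _ hy)
    rwa [mul_inv, mul_mul_mul_comm, inv_mul_cancel₀ hz0, one_mul] at this
  have hzh' : ∀ x ∈ h.map fun x => z * x, x ^ N = 1 := by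
    simpa using hzh
  rcases hred.classification hN.ne' (hmv.map_mul hz0) (by simpa using hcard) hzh' with
    ⟨w, hw, heq⟩ | ⟨J, hJ, hJ2, w, hw, heq⟩
  · refine Or.inl ⟨z⁻¹ * w, hz.inv.mul hw, ?_⟩
    have := congrArg (Multiset.map fun x => z⁻¹ * x) heq
    simpa [Multiset.map_map, hz0, Function.comp_def, mul_assoc] using this
  · refine Or.inr ⟨J, hJ, hJ2, w * z, hw.mul hz, ?_⟩
    rw [← heq, Multiset.map_map]
    simp only [Function.comp_def, mul_assoc]
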